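/- arXiv:1302.0982 — 2 statements merged into one kernel-verified Lean document; each statement's English description precedes it below -/
import Mathlib

section
/- Let p, k ≥ 1, s ≥ 2, q ≥ 0, and 1 ≤ r < p be integers. Then the rewriting system on the alphabet {a,b} with rules: a^p b^{q+s} a^{r+pk} b^s → b, together with a^p b^{q+s} a^{r+pi} b → b^{q+1} (a^{r+pk} b^{q+2s−1})^{k−1−i} a^{r+pk} b^s for each i with 0 ≤ i ≤ k−1, is confluent and terminating, and the monoid it presents is isomorphic to Mon⟨a,b : a^p b^{q+s} a^{r+pk} b^s = b⟩. -/
open Relation FreeMonoid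

/-- Words over the alphabet `A`: the free monoid on `A`. -/
abbrev Word (A : Type) : Type := FreeMonoid A

/-- One-step rewriting relation of the rewriting system `R`. -/
def OneStep {A : Type} (R : Set (Word A × Word A)) (x y : Word A) : Prop :=
  ∃ u v l r : Word A, (l, r) ∈ R ∧ x = u * l * v ∧ y = u * r * v

/-- Confluence of the rewriting system `R`. -/
def IsConfluent {A : Type} (R : Set (Word A × Word A)) : Prop :=
  ∀ w x y : Word A, ReflTransGen (OneStep R) w x → ReflTransGen (OneStep R) w y →
    ∃ z : Word A, ReflTransGen (OneStep R) x z ∧ ReflTransGen (OneStep R) y z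

/-- Termination of the rewriting system `R`: no infinite rewriting chain. -/
def IsTerminating {A : Type} (R : Set (Word A × Word A)) : Prop :=
  ¬ ∃ f : ℕ → Word A, ∀ n : ℕ, OneStep R (f n) (f (n + 1))

/-- The monoid presented by generators `A` and relations `R`: the quotient of the
free monoid on `A` by the congruence generated by `R`. -/
abbrev MonPres {A : Type} (R : Set (Word A × Word A)) : Type :=
  (conGen fun x y : Word A => (x, y) ∈ R).Quotient

/-- The canonical projection from words to the presented monoid. -/
def presMk {A : Type} (R : Set (Word A × Word A)) : Word A →* MonPres R :=
  Con.mk' _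

/-- A two-letter alphabet. -/
inductive AB : Type | a | b

/-- A three-letter alphabet. -/
inductive ABX : Type | a | b | x


/-! ### Rewriting systems -/

theorem OneStep.mul {A : Type} {R : Set (Word A × Word A)} {x y : Word A} (h : OneStep R x y)
    (u v : Word A) : OneStep R (u * x * v) (u * y * v) := by
  obtain ⟨u', v', l, r, hlr, rfl, rfl⟩ := h
  exact ⟨u * u', v' * v, l, r, hlr, by simp only [mul_assoc], by simp only [mul_assoc]⟩

theorem OneStep.of_mem {A : Type} {R : Set (Word A × Word A)} {l r : Word A} (h : (l, r) ∈ R)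
    (u v : Word A) : OneStep R (u * l * v) (u * r * v) :=
  ⟨u, v, l, r, h, rfl, rfl⟩

theorem reflTransGen_oneStep_mul {A : Type} {R : Set (Word A × Word A)} {x y : Word A}
    (h : ReflTransGen (OneStep R) x y) (u v : Word A) :
    ReflTransGen (OneStep R) (u * x * v) (u * y * v) :=
  h.lift (fun w => u * w * v) fun _ _ h => h.mul u v

theorem con_of_reflTransGen_oneStep {A : Type} {R : Set (Word A × Word A)} {c : Con (Word A)}
    (hc : ∀ l r, (l, r) ∈ R → c l r) {x y : Word A} (h : ReflTransGen (OneStep R) x y) :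
    c x y := by
  induction h with
  | refl => exact c.refl _
  | tail _ h ih =>
    obtain ⟨u, v, l, r, hlr, rfl, rfl⟩ := h
    exact c.trans ih (c.mul (c.mul (c.refl u) (hc l r hlr)) (c.refl v))

/-- **Newman's lemma** for rewriting systems. -/
theorem IsConfluent.of_locally {A : Type} {R : Set (Word A × Word A)}
    (hwf : WellFounded fun y x => OneStep R x y)
    (hloc : ∀ w x y, OneStep R w x → OneStep R w y → Join (ReflTransGen (OneStep R)) x y) :
    IsConfluent R := by
  intro w
  induction w using hwf.induction with
  | _ w ih =>
    intro x y hx hy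
    obtain rfl | ⟨x', hwx, hx⟩ := ReflTransGen.cases_head hx
    · exact ⟨y, hy, .refl⟩
    obtain rfl | ⟨y', hwy, hy⟩ := ReflTransGen.cases_head hy
    · exact ⟨x, .refl, .head hwx hx⟩
    obtain ⟨z, hxz, hyz⟩ := hloc w x' y' hwx hwy
    obtain ⟨z₁, h₁, h₂⟩ := ih x' hwx x z hx hxz
    obtain ⟨z₂, h₃, h₄⟩ := ih y' hwy z₁ y (hyz.trans h₂) hy
    exact ⟨z₂, h₁.trans h₃, h₄⟩

theorem word_mul_eq_mul {A : Type} {u x u' y : Word A} (h : u * x = u' * y) :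
    (∃ t : Word A, u' = u * t ∧ x = t * y) ∨ ∃ t : Word A, u = u' * t ∧ y = t * x :=
  List.append_eq_append_iff.1 h

/-- Local confluence only has to be checked where the left redex starts the word. -/
theorem join_of_peaks {A : Type} {R : Set (Word A × Word A)}
    (hpeak : ∀ l r l' r' t v v' : Word A, (l, r) ∈ R → (l', r') ∈ R → l * v = t * l' * v' →
      Join (ReflTransGen (OneStep R)) (r * v) (t * r' * v'))
    (w x y : Word A) (hx : OneStep R w x) (hy : OneStep R w y) :
    Join (ReflTransGen (OneStep R)) x y := by
  obtain ⟨u, v, l, r, hlr, rfl, rfl⟩ := hx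
  obtain ⟨u', v', l', r', hlr', he, rfl⟩ := hy
  rw [mul_assoc, mul_assoc] at he
  obtain ⟨t, rfl, ht⟩ | ⟨t, rfl, ht⟩ := word_mul_eq_mul he
  · obtain ⟨z, h₁, h₂⟩ := hpeak l r l' r' t v v' hlr hlr' (ht.trans (mul_assoc t l' v').symm)
    refine ⟨u * z, ?_, ?_⟩
    · simpa only [mul_assoc, mul_one] using reflTransGen_oneStep_mul h₁ u 1
    · simpa only [mul_assoc, mul_one] using reflTransGen_oneStep_mul h₂ u 1
  · obtain ⟨z, h₁, h₂⟩ := hpeak l' r' l r t v' v hlr' hlr (ht.trans (mul_assoc t l v).symm)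
    refine ⟨u' * z, ?_, ?_⟩
    · simpa only [mul_assoc, mul_one] using reflTransGen_oneStep_mul h₂ u' 1
    · simpa only [mul_assoc, mul_one] using reflTransGen_oneStep_mul h₁ u' 1

/-! ### Words over a two-letter alphabet -/

theorem of_mul_inj {c d : AB} {x y : Word AB} (h : of c * x = of d * y) : c = d ∧ x = y :=
  List.cons.inj h

theorem word_cases (t : Word AB) : t = 1 ∨ ∃ c t', t = of c * t' := by
  cases t using FreeMonoid.casesOn with
  | one => exact .inl rfl
  | of_mul c t' => exact .inr ⟨c, t', rfl⟩

theorem a_pow_mul_b_inj {n m : ℕ} {x y : Word AB}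
    (h : (of AB.a) ^ n * (of AB.b * y) = (of AB.a) ^ m * (of AB.b * x)) : n = m ∧ y = x := by
  induction n generalizing m with
  | zero =>
    cases m with
    | zero => exact ⟨rfl, (of_mul_inj (mul_left_cancel h)).2⟩
    | succ m =>
      rw [pow_zero, one_mul, pow_succ', mul_assoc] at h
      cases (of_mul_inj h).1
  | succ n ih =>
    cases m with
    | zero =>
      rw [pow_zero, one_mul, pow_succ', mul_assoc] at h
      cases (of_mul_inj h).1
    | succ m =>
      rw [pow_succ', pow_succ', mul_assoc, mul_assoc] at h
      obtain ⟨rfl, rfl⟩ := ih (of_mul_inj h).2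
      exact ⟨rfl, rfl⟩

theorem mul_a_pow_mul_b_eq {p m : ℕ} (hp : 1 ≤ p) {t x y : Word AB}
    (h : t * ((of AB.a) ^ p * (of AB.b * y)) = (of AB.a) ^ m * (of AB.b * x)) :
    (∃ j, j + p = m ∧ t = (of AB.a) ^ j ∧ y = x) ∨
      ∃ t', t = (of AB.a) ^ m * of AB.b * t' ∧ t' * ((of AB.a) ^ p * (of AB.b * y)) = x := by
  induction m generalizing t with
  | zero =>
    obtain ⟨p, rfl⟩ := Nat.exists_eq_add_of_le' hp
    rw [pow_zero, one_mul] at h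
    obtain rfl | ⟨c, t, rfl⟩ := word_cases t
    · rw [one_mul, pow_succ', mul_assoc] at h
      cases (of_mul_inj h).1
    · rw [mul_assoc] at h
      obtain ⟨rfl, h'⟩ := of_mul_inj h
      exact .inr ⟨t, by simp, h'⟩
  | succ m ih =>
    obtain rfl | ⟨c, t, rfl⟩ := word_cases t
    · rw [one_mul] at h
      obtain ⟨rfl, rfl⟩ := a_pow_mul_b_inj h
      exact .inl ⟨0, by simp, by simp, rfl⟩
    · rw [pow_succ', mul_assoc, mul_assoc] at h
      obtain ⟨rfl, h'⟩ := of_mul_inj h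
      obtain ⟨j, hj, rfl, rfl⟩ | ⟨t', rfl, rfl⟩ := ih h'
      · exact .inl ⟨j + 1, by omega, by rw [pow_succ'], rfl⟩
      · exact .inr ⟨t', by simp only [pow_succ', mul_assoc], rfl⟩

theorem mul_a_pow_eq_b_pow_mul {p m : ℕ} (hp : 1 ≤ p) {t x y : Word AB}
    (h : t * ((of AB.a) ^ p * y) = (of AB.b) ^ m * x) :
    ∃ t', t = (of AB.b) ^ m * t' ∧ t' * ((of AB.a) ^ p * y) = x := by
  induction m generalizing t with
  | zero => exact ⟨t, by simp, by simpa using h⟩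
  | succ m ih =>
    obtain ⟨p, rfl⟩ := Nat.exists_eq_add_of_le' hp
    rw [pow_succ' _ m, mul_assoc] at h
    obtain rfl | ⟨c, t, rfl⟩ := word_cases t
    · rw [one_mul, pow_succ', mul_assoc] at h
      cases (of_mul_inj h).1
    · rw [mul_assoc] at h
      obtain ⟨rfl, h'⟩ := of_mul_inj h
      obtain ⟨t', rfl, h''⟩ := ih h'
      exact ⟨t', by simp only [pow_succ', mul_assoc], h''⟩

/-! ### The rewriting system -/

/-- The rewriting system of the theorem. -/
def abRules (p k s q r : ℕ) : Set (Word AB × Word AB) :=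
  insert ((of AB.a)^p * (of AB.b)^(q+s) * (of AB.a)^(r+p*k) * (of AB.b)^s, of AB.b)
    {pr : Word AB × Word AB | ∃ i < k,
      pr = ((of AB.a)^p * (of AB.b)^(q+s) * (of AB.a)^(r+p*i) * of AB.b,
        (of AB.b)^(q+1) * ((of AB.a)^(r+p*k) * (of AB.b)^(q+2*s-1))^(k-1-i) *
          (of AB.a)^(r+p*k) * (of AB.b)^s)}

/-- The length of the final block of `b` in the left-hand side of the rule of index `i ≤ k`. -/
def tailLength (k s i : ℕ) : ℕ := if i < k then 1 else s

/-- The left-hand side of the rule of index `i ≤ k`, the index `k` being that of the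
length-reducing rule. -/
def lhsWord (p k s q r i : ℕ) : Word AB :=
  (of AB.a)^p * (of AB.b)^(q+s) * (of AB.a)^(r+p*i) * (of AB.b)^(tailLength k s i)

/-- The right-hand side of the rule of index `i ≤ k`. -/
def rhsWord (p k s q r i : ℕ) : Word AB :=
  if i < k then (of AB.b)^(q+1) * ((of AB.a)^(r+p*k) * (of AB.b)^(q+2*s-1))^(k-1-i) *
    (of AB.a)^(r+p*k) * (of AB.b)^s
  else of AB.b

theorem mem_abRules_iff {p k s q r : ℕ} {x y : Word AB} : (x, y) ∈ abRules p k s q r ↔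
    ∃ i ≤ k, x = lhsWord p k s q r i ∧ y = rhsWord p k s q r i := by
  simp only [abRules, Set.mem_insert_iff, Set.mem_ofPred_eq, Prod.mk.injEq]
  constructor
  · rintro (⟨rfl, rfl⟩ | ⟨i, hi, rfl, rfl⟩)
    · exact ⟨k, le_rfl, by simp [lhsWord, tailLength], by simp [rhsWord]⟩
    · exact ⟨i, hi.le, by simp [lhsWord, tailLength, hi], by simp [rhsWord, hi]⟩
  · rintro ⟨i, hi, rfl, rfl⟩
    obtain hi | rfl := hi.lt_or_eq
    · exact .inr ⟨i, hi, by simp [lhsWord, tailLength, hi], by simp [rhsWord, hi]⟩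
    · exact .inl ⟨by simp [lhsWord, tailLength], by simp [rhsWord]⟩

/-- Repeated use of the length-reducing rule erases a chain of blocks. -/
theorem reduce_chain {p k s q r : ℕ} (hs : 2 ≤ s) {R : Set (Word AB × Word AB)}
    (hR : ((of AB.a)^p * (of AB.b)^(q+s) * (of AB.a)^(r+p*k) * (of AB.b)^s, of AB.b) ∈ R)
    (c m : ℕ) :
    ReflTransGen (OneStep R) ((of AB.a)^(c+p*(m+1)) * (of AB.b)^(q+s) *
      ((of AB.a)^(r+p*k) * (of AB.b)^(q+2*s-1))^m * (of AB.a)^(r+p*k) * (of AB.b)^s)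
      ((of AB.a)^c * of AB.b) := by
  induction m with
  | zero =>
    refine .single ?_
    convert OneStep.of_mem hR ((of AB.a)^c) 1 using 1 <;>
      simp [pow_add, mul_assoc]
  | succ m ih =>
    refine .head ?_ ih
    convert OneStep.of_mem hR ((of AB.a)^(c+p*(m+1))) ((of AB.b)^(q+s-1) *
      (((of AB.a)^(r+p*k) * (of AB.b)^(q+2*s-1))^m * (of AB.a)^(r+p*k) * (of AB.b)^s)) using 1
    · rw [show c + p * (m + 1 + 1) = c + p * (m + 1) + p by ring, pow_add _ (c + p * (m + 1)) p,
        pow_succ' _ m, show q + 2 * s - 1 = s + (q + s - 1) by omega, pow_add _ s (q + s - 1)]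
      simp only [mul_assoc]
    · conv_lhs => rw [show q + s = 1 + (q + s - 1) by omega, pow_add _ 1 (q + s - 1), pow_one]
      simp only [mul_assoc]

/-! ### Termination -/

/-- The effect of a letter, prepended to a word `w`, on the triple consisting of the weight of `w`,
the number of its short blocks of `b` not at the start of `w`, and the length of its initial block
of `b`. A block of `b` is short when its length is at most `N`, and an `a` with `c` short blocks
to its right weighs `K ^ c`. -/
def letterAct (K N : ℕ) : AB → Function.End (ℕ × ℕ × ℕ)
  | AB.a => fun x =>
    let e := x.2.1 + if 1 ≤ x.2.2 ∧ x.2.2 ≤ N then 1 else 0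
    (x.1 + K ^ e, e, 0)
  | AB.b => fun x => (x.1, x.2.1, x.2.2 + 1)

/-- The action of words generated by `letterAct`. -/
def wordAct (K N : ℕ) : Word AB →* Function.End (ℕ × ℕ × ℕ) := lift (letterAct K N)

theorem wordAct_mul (K N : ℕ) (u v : Word AB) (x : ℕ × ℕ × ℕ) :
    wordAct K N (u * v) x = wordAct K N u (wordAct K N v x) := by
  rw [map_mul]; rfl

theorem wordAct_of (K N : ℕ) (c : AB) : wordAct K N (of c) = letterAct K N c :=
  lift_eval_of _ _

theorem wordAct_b_pow (K N n V C m : ℕ) :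
    wordAct K N ((of AB.b) ^ n) (V, C, m) = (V, C, m + n) := by
  induction n with
  | zero => rw [pow_zero, map_one]; rfl
  | succ n ih => rw [pow_succ', wordAct_mul, ih, wordAct_of]; rfl

theorem wordAct_a_pow (K N V C m : ℕ) {n : ℕ} (hn : 1 ≤ n) :
    wordAct K N ((of AB.a) ^ n) (V, C, m) =
      (V + n * K ^ (C + if 1 ≤ m ∧ m ≤ N then 1 else 0),
        C + if 1 ≤ m ∧ m ≤ N then 1 else 0, 0) := by
  induction n, hn using Nat.le_induction with
  | base => rw [pow_one, wordAct_of, one_mul]; rfl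
  | succ n _ ih =>
    rw [pow_succ', wordAct_mul, ih, wordAct_of]
    simp only [letterAct]
    ext <;> simp
    ring

theorem wordAct_chain (K N V C M : ℕ) {n : ℕ} (hn : 1 ≤ n) (hM : N < M) (j : ℕ) :
    wordAct K N (((of AB.a) ^ n * (of AB.b) ^ M) ^ j) (V, C, 0) = (V + j * n * K ^ C, C, 0) := by
  induction j with
  | zero => rw [pow_zero, map_one]; simp; rfl
  | succ j ih =>
    rw [pow_succ', wordAct_mul, ih, wordAct_mul, wordAct_b_pow, wordAct_a_pow _ _ _ _ _ hn,
      if_neg (by omega)]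
    ext <;> simp
    ring

/-- The state `y` is smaller than `x`: it has smaller weight, and no more short blocks, whatever the
number of letters `b` to be prepended. -/
def StateLT (N : ℕ) (y x : ℕ × ℕ × ℕ) : Prop :=
  y.1 < x.1 ∧ ∀ t, y.2.1 + (if 1 ≤ y.2.2 + t ∧ y.2.2 + t ≤ N then 1 else 0) ≤
    x.2.1 + (if 1 ≤ x.2.2 + t ∧ x.2.2 + t ≤ N then 1 else 0)

theorem StateLT.wordAct {K N : ℕ} (hK : 1 ≤ K) {y x : ℕ × ℕ × ℕ} (h : StateLT N y x)
    (u : Word AB) : StateLT N (wordAct K N u y) (wordAct K N u x) := by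
  induction u using FreeMonoid.inductionOn' with
  | one =>
    rw [map_one]
    exact h
  | of_mul c u ih =>
    rw [wordAct_mul, wordAct_mul, wordAct_of]
    generalize _root_.wordAct K N u y = y at ih
    generalize _root_.wordAct K N u x = x at ih
    obtain ⟨h₁, h₂⟩ := ih
    cases c with
    | a =>
      have h₀ := h₂ 0
      simp only [add_zero] at h₀
      exact ⟨add_lt_add_of_lt_of_le h₁ (Nat.pow_le_pow_right hK h₀),
        fun t => by simpa [letterAct] using h₀⟩
    | b =>
      refine ⟨h₁, fun t => ?_⟩
      simpa only [letterAct, add_assoc] using h₂ (1 + t)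

theorem stateLT_rule {p k s q r : ℕ} (hp : 1 ≤ p) (hk : 1 ≤ k) (hs : 2 ≤ s) (hr : 1 ≤ r)
    {x y : Word AB} (h : (x, y) ∈ abRules p k s q r) (z : ℕ × ℕ × ℕ) :
    StateLT (q + s) (wordAct (k * (r + p * k)) (q + s) y z)
      (wordAct (k * (r + p * k)) (q + s) x z) := by
  obtain ⟨V, C, m⟩ := z
  set K := k * (r + p * k) with hK
  have hα : 1 ≤ r + p * k := by omega
  have hK1 : 1 ≤ K := Nat.mul_pos hk hα
  simp only [abRules, Set.mem_insert_iff, Set.mem_ofPred_eq, Prod.mk.injEq] at h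
  obtain ⟨rfl, rfl⟩ | ⟨i, hi, rfl, rfl⟩ := h
  · rw [← pow_one (of AB.b), ← pow_mul, ← pow_mul]
    simp only [wordAct_mul, wordAct_b_pow, wordAct_a_pow _ _ _ _ _ hp,
      wordAct_a_pow _ _ _ _ _ hα, one_mul]
    refine ⟨?_, fun t => ?_⟩
    · have := Nat.mul_pos hp (Nat.pow_pos (n := C + (if 1 ≤ m + s ∧ m + s ≤ q + s then 1 else 0) +
        if 1 ≤ 0 + (q + s) ∧ 0 + (q + s) ≤ q + s then 1 else 0) hK1)
      dsimp only
      omega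
    · dsimp only
      split_ifs <;> omega
  · have hβ : 1 ≤ r + p * i := by omega
    rw [← pow_one (of AB.b), ← pow_mul, ← pow_mul, ← pow_mul, ← pow_mul]
    simp only [wordAct_mul, wordAct_b_pow, wordAct_a_pow _ _ _ _ _ hp,
      wordAct_a_pow _ _ _ _ _ hα, wordAct_a_pow _ _ _ _ _ hβ, one_mul,
      wordAct_chain _ _ _ _ _ hα (show q + s < q + 2 * s - 1 by omega)]
    set e₁ := C + if 1 ≤ m + 1 ∧ m + 1 ≤ q + s then 1 else 0 with he₁
    set e₂ := C + if 1 ≤ m + s ∧ m + s ≤ q + s then 1 else 0 with he₂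
    have he : e₂ ≤ e₁ := by
      rw [he₁, he₂]
      split_ifs <;> omega
    rw [if_pos (by omega)]
    refine ⟨?_, fun t => ?_⟩
    · have h₁ : K ^ e₂ ≤ K ^ e₁ := Nat.pow_le_pow_right hK1 he
      have h₂ : 1 ≤ K ^ e₁ := Nat.pow_pos hK1
      obtain ⟨j, rfl⟩ : ∃ j, k = i + 1 + j := ⟨k - 1 - i, by omega⟩
      rw [show i + 1 + j - 1 - i = j by omega]
      calc V + (r + p * (i + 1 + j)) * K ^ e₂ + j * (r + p * (i + 1 + j)) * K ^ e₂
          = V + ((j + 1) * (r + p * (i + 1 + j))) * K ^ e₂ := by ring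
        _ ≤ V + K * K ^ e₁ := by
          gcongr
          exact Nat.mul_le_mul_right _ (by omega)
        _ < V + (r + p * i) * K ^ e₁ + 1 * (K * K ^ e₁) := by
          have := Nat.mul_pos hβ h₂
          omega
        _ ≤ V + (r + p * i) * K ^ e₁ + p * K ^ (e₁ + 1) := by
          rw [pow_succ']
          gcongr
    · dsimp only
      split_ifs <;> omega

theorem wellFounded_abRules {p k s q r : ℕ} (hp : 1 ≤ p) (hk : 1 ≤ k) (hs : 2 ≤ s) (hr : 1 ≤ r) :
    WellFounded fun y x => OneStep (abRules p k s q r) x y := by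
  refine Subrelation.wf (fun {y x} h => ?_)
    (measure fun w => (wordAct (k * (r + p * k)) (q + s) w (0, 0, 0)).1).wf
  obtain ⟨u, v, l, r', hlr, rfl, rfl⟩ := h
  have hK : 1 ≤ k * (r + p * k) := Nat.mul_pos hk (by omega)
  have := ((stateLT_rule hp hk hs hr hlr
    (wordAct (k * (r + p * k)) (q + s) v (0, 0, 0))).wordAct hK u).1
  rw [← wordAct_mul, ← wordAct_mul, ← wordAct_mul, ← wordAct_mul] at this
  exact this

/-! ### Critical pairs -/

theorem rhsWord_mul_b_pow {p k s q r i : ℕ} (hs : 2 ≤ s) (hi : i ≤ k) :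
    rhsWord p k s q r i * (of AB.b) ^ (q + s - tailLength k s i) =
      (of AB.b)^(q+1) * ((of AB.a)^(r+p*k) * (of AB.b)^(q+2*s-1))^(k-i) := by
  obtain hi | rfl := hi.lt_or_eq
  · rw [rhsWord, tailLength, if_pos hi, if_pos hi, show k - i = k - 1 - i + 1 by omega,
      pow_succ _ (k - 1 - i), show q + 2 * s - 1 = s + (q + s - 1) by omega, pow_add _ s]
    simp only [mul_assoc]
  · simp [rhsWord, tailLength, pow_succ']

theorem join_critical {p k s q r i j : ℕ} (hs : 2 ≤ s) (hi : i < k) (hj : j ≤ k) :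
    Join (ReflTransGen (OneStep (abRules p k s q r)))
      ((of AB.b)^(q+1) * ((of AB.a)^(r+p*k) * (of AB.b)^(q+2*s-1))^(k-1-i) *
        (of AB.a)^(r+p*j) * (of AB.b)^(tailLength k s j))
      ((of AB.a)^p * (of AB.b)^(q+s) * (of AB.a)^(r+p*i) * rhsWord p k s q r j) := by
  have hmem : ((of AB.a)^p * (of AB.b)^(q+s) * (of AB.a)^(r+p*i) * of AB.b,
      (of AB.b)^(q+1) * ((of AB.a)^(r+p*k) * (of AB.b)^(q+2*s-1))^(k-1-i) *
        (of AB.a)^(r+p*k) * (of AB.b)^s) ∈ abRules p k s q r := .inr ⟨i, hi, rfl⟩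
  refine ⟨_, .refl, ?_⟩
  obtain hj | rfl := hj.lt_or_eq
  · rw [rhsWord, tailLength, if_pos hj, if_pos hj, pow_one]
    have h₁ := OneStep.of_mem hmem 1 ((of AB.b)^q *
      (((of AB.a)^(r+p*k) * (of AB.b)^(q+2*s-1))^(k-1-j) * (of AB.a)^(r+p*k) * (of AB.b)^s))
    have h₂ := reflTransGen_oneStep_mul
      (reduce_chain (R := abRules p k s q r) hs (.inl rfl) (r + p * j) (k - 1 - j))
      ((of AB.b)^(q+1) * ((of AB.a)^(r+p*k) * (of AB.b)^(q+2*s-1))^(k-1-i)) 1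
    obtain ⟨d, rfl⟩ : ∃ d, k = j + 1 + d := ⟨k - 1 - j, by omega⟩
    rw [show j + 1 + d - 1 - j = d by omega] at *
    rw [show r + p * j + p * (d + 1) = r + p * (j + 1 + d) by ring, add_comm q s,
      pow_add _ s q] at h₂
    rw [add_comm q 1, pow_add _ 1 q, pow_one] at h₁
    rw [add_comm q 1, pow_add _ 1 q, pow_one] at *
    simp only [mul_assoc, one_mul, mul_one] at h₁ h₂ ⊢
    exact .head h₁ h₂
  · rw [rhsWord, tailLength, if_neg (lt_irrefl _), if_neg (lt_irrefl _)]
    simpa only [one_mul, mul_one] using ReflTransGen.single (OneStep.of_mem hmem 1 1)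

theorem join_peak {p k s q r : ℕ} (hp : 1 ≤ p) (hs : 2 ≤ s) (hr : r < p)
    (l d l' d' t v v' : Word AB) (hl : (l, d) ∈ abRules p k s q r)
    (hl' : (l', d') ∈ abRules p k s q r) (h : l * v = t * l' * v') :
    Join (ReflTransGen (OneStep (abRules p k s q r))) (d * v) (t * d' * v') := by
  have hstep := OneStep.of_mem hl
  have hstep' := OneStep.of_mem hl'
  obtain ⟨i, hi, rfl, rfl⟩ := mem_abRules_iff.1 hl
  obtain ⟨j, hj, rfl, rfl⟩ := mem_abRules_iff.1 hl'
  have hsplit : ∀ i, ∃ f, tailLength k s i = f + 1 ∧ f + 1 ≤ s := fun i => by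
    unfold tailLength
    split_ifs
    · exact ⟨0, rfl, by omega⟩
    · exact ⟨s - 1, by omega, by omega⟩
  obtain ⟨f, hf, hfs⟩ := hsplit i
  obtain ⟨g, hg, -⟩ := hsplit j
  obtain ⟨n, hn⟩ : ∃ n, q + s = n + 1 := ⟨q + s - 1, by omega⟩
  have h' : t * ((of AB.a)^p * (of AB.b * ((of AB.b)^n * ((of AB.a)^(r+p*j) *
      (of AB.b * ((of AB.b)^g * v')))))) = (of AB.a)^p * (of AB.b * ((of AB.b)^n *
        ((of AB.a)^(r+p*i) * (of AB.b * ((of AB.b)^f * v))))) := by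
    simpa only [lhsWord, hf, hg, hn, pow_succ', mul_assoc] using h.symm
  obtain ⟨c, hc, rfl, he⟩ | ⟨t, rfl, he⟩ := mul_a_pow_mul_b_eq hp h'
  · obtain rfl : c = 0 := by omega
    obtain ⟨hij, he'⟩ := a_pow_mul_b_inj (mul_left_cancel he)
    obtain rfl : j = i := Nat.eq_of_mul_eq_mul_left hp (by omega)
    obtain rfl : g = f := by omega
    obtain rfl := mul_left_cancel he'
    rw [pow_zero, one_mul]
    exact ⟨_, .refl, .refl⟩
  obtain ⟨t, rfl, he'⟩ := mul_a_pow_eq_b_pow_mul hp he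
  obtain ⟨c, hc, rfl, hy⟩ | ⟨t, rfl, hy⟩ := mul_a_pow_mul_b_eq hp he'
  · obtain ⟨i, rfl⟩ : ∃ i', i = i' + 1 := by
      refine Nat.exists_eq_succ_of_ne_zero ?_
      rintro rfl
      omega
    obtain rfl : c = r + p * i := by
      rw [mul_add] at hc
      omega
    obtain ⟨o, rfl⟩ : ∃ o, n = f + o := ⟨n - f, by omega⟩
    rw [pow_add, mul_assoc] at hy
    obtain rfl := mul_left_cancel hy
    obtain ⟨z, h₁, h₂⟩ := join_critical (p := p) (q := q) (r := r) hs (show i < k by omega) hj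
    refine ⟨z * v', ?_, ?_⟩
    · have hrhs := rhsWord_mul_b_pow (p := p) (q := q) (r := r) hs hi
      rw [hf, show q + s - (f + 1) = o by omega, show k - (i + 1) = k - 1 - i by omega] at hrhs
      have h₃ := reflTransGen_oneStep_mul h₁ 1 v'
      rw [← hrhs, hg] at h₃
      simpa only [pow_succ', mul_assoc, one_mul] using h₃
    · have h₃ := reflTransGen_oneStep_mul h₂ 1 v'
      rw [hn] at h₃
      simpa only [pow_succ', mul_assoc, one_mul] using h₃
  · obtain ⟨t, rfl, rfl⟩ := mul_a_pow_eq_b_pow_mul hp hy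
    refine ⟨rhsWord p k s q r i * t * rhsWord p k s q r j * v', .single ?_, .single ?_⟩
    · have := hstep' (rhsWord p k s q r i * t) v'
      nth_rewrite 1 [lhsWord] at this
      simpa only [hg, hn, pow_succ', mul_assoc] using this
    · have := hstep 1 (t * rhsWord p k s q r j * v')
      nth_rewrite 1 [lhsWord] at this
      simpa only [hf, hn, pow_succ', mul_assoc, one_mul] using this

theorem conGen_abRules {p k s q r : ℕ} (hs : 2 ≤ s) :
    (conGen fun x y : Word AB => (x, y) ∈ abRules p k s q r) =
      conGen fun x y : Word AB => (x, y) ∈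
        ({((of AB.a)^p * (of AB.b)^(q+s) * (of AB.a)^(r+p*k) * (of AB.b)^s, of AB.b)} :
          Set (Word AB × Word AB)) := by
  refine le_antisymm (Con.conGen_le.2 ?_) (Con.conGen_le.2 ?_)
  · rintro x y (h | ⟨i, hi, h⟩)
    · exact ConGen.Rel.of _ _ h
    · obtain ⟨rfl, rfl⟩ := Prod.mk.inj h
      set R : Set (Word AB × Word AB) :=
        {((of AB.a)^p * (of AB.b)^(q+s) * (of AB.a)^(r+p*k) * (of AB.b)^s, of AB.b)} with hR
      have hmem : ((of AB.a)^p * (of AB.b)^(q+s) * (of AB.a)^(r+p*k) * (of AB.b)^s, of AB.b) ∈ R :=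
        rfl
      have h₁ := reflTransGen_oneStep_mul (reduce_chain hs hmem (r + p * i) (k - 1 - i))
        ((of AB.a)^p * (of AB.b)^(q+s)) 1
      have h₂ := ReflTransGen.single (OneStep.of_mem hmem 1 ((of AB.b)^q *
        (((of AB.a)^(r+p*k) * (of AB.b)^(q+2*s-1))^(k-1-i) * (of AB.a)^(r+p*k) * (of AB.b)^s)))
      have hcon : ∀ l r, (l, r) ∈ R → (conGen fun x y : Word AB => (x, y) ∈ R) l r :=
        fun l r h => ConGen.Rel.of _ _ h
      have c₁ := con_of_reflTransGen_oneStep hcon h₁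
      have c₂ := con_of_reflTransGen_oneStep hcon h₂
      refine Con.trans _ (Con.symm _ ?_) (Con.trans _ c₂ ?_)
      · convert c₁ using 1
        · obtain ⟨d, hd⟩ : ∃ d, k = i + 1 + d := ⟨k - 1 - i, by omega⟩
          rw [show r + p * i + p * (k - 1 - i + 1) = r + p * k by
            rw [hd, show i + 1 + d - 1 - i = d by omega]; ring]
          have hpow (X : Word AB) :
              (of AB.b)^s * ((of AB.b)^q * X) = (of AB.b)^(q+s) * X := by
            rw [← mul_assoc, ← pow_add, add_comm]
          simp only [mul_assoc, one_mul, mul_one, hpow]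
        · simp only [mul_assoc, mul_one]
      · rw [pow_succ' _ q]
        simp only [mul_assoc, one_mul]
        exact Con.refl _ _
  · rintro x y h
    exact ConGen.Rel.of _ _ (.inl h)

/-- Case 2 (`s > 1`, `r > 0`) of Theorem 3.1: the displayed rewriting system is complete and
presents `Mon⟨a,b : a^p b^(q+s) a^(r+pk) b^s = b⟩`. -/
theorem stmt3 (p k s q r : ℕ) (hp : 1 ≤ p) (hk : 1 ≤ k) (hs : 2 ≤ s) (hr1 : 1 ≤ r) (hr : r < p) :
    IsConfluent (insert ((of AB.a)^p * (of AB.b)^(q+s) * (of AB.a)^(r+p*k) * (of AB.b)^s, of AB.b)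
      {pr : Word AB × Word AB | ∃ i < k,
        pr = ((of AB.a)^p * (of AB.b)^(q+s) * (of AB.a)^(r+p*i) * of AB.b,
              (of AB.b)^(q+1) * ((of AB.a)^(r+p*k) * (of AB.b)^(q+2*s-1))^(k-1-i) * (of AB.a)^(r+p*k) * (of AB.b)^s)}) ∧
    IsTerminating (insert ((of AB.a)^p * (of AB.b)^(q+s) * (of AB.a)^(r+p*k) * (of AB.b)^s, of AB.b)
      {pr : Word AB × Word AB | ∃ i < k,
        pr = ((of AB.a)^p * (of AB.b)^(q+s) * (of AB.a)^(r+p*i) * of AB.b,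
              (of AB.b)^(q+1) * ((of AB.a)^(r+p*k) * (of AB.b)^(q+2*s-1))^(k-1-i) * (of AB.a)^(r+p*k) * (of AB.b)^s)}) ∧
    Nonempty (MonPres (insert ((of AB.a)^p * (of AB.b)^(q+s) * (of AB.a)^(r+p*k) * (of AB.b)^s, of AB.b)
      {pr : Word AB × Word AB | ∃ i < k,
        pr = ((of AB.a)^p * (of AB.b)^(q+s) * (of AB.a)^(r+p*i) * of AB.b,
              (of AB.b)^(q+1) * ((of AB.a)^(r+p*k) * (of AB.b)^(q+2*s-1))^(k-1-i) * (of AB.a)^(r+p*k) * (of AB.b)^s)}) ≃*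
      MonPres ({((of AB.a)^p * (of AB.b)^(q+s) * (of AB.a)^(r+p*k) * (of AB.b)^s, of AB.b)} :
        Set (Word AB × Word AB))) := by
  have hwf := wellFounded_abRules (q := q) hp hk hs hr1
  refine ⟨IsConfluent.of_locally hwf (join_of_peaks (join_peak hp hs hr)), ?_,
    ⟨Con.congr (.refl _) (conGen_abRules hs)⟩⟩
  rintro ⟨f, hf⟩
  exact (wellFounded_iff_isEmpty_descending_chain.1 hwf).false ⟨f, hf⟩
end

section
/- Let p ≥ 1, s ≥ 2, k ≥ 2, and 0 ≤ q < s−1 be integers. Then the rewriting system on the three-letter alphabet {a,b,x} with rules: a^p x b^q x b^{s−1} → x; a^p b → x b^q x (b^{q+s−1} x)^{k−2}; x b^q x (b^{q+s−1} x)^{k−1} → b; x b^q x (b^{q+s−1} x)^{k−2} b^{q+s} → b^{q+1} x (b^{q+s−1} x)^{k−1}, is confluent and terminating, and the monoid it presents is isomorphic to Mon⟨a,b : a^p b^{q+s} a^{pk} b^s = b⟩. -/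
open Relation FreeMonoid

section Rewriting

variable {A : Type} {R : Set (Word A × Word A)}

/-- Two words are joinable when they have a common descendant. -/
def Joinable (R : Set (Word A × Word A)) (y z : Word A) : Prop :=
  ∃ w, ReflTransGen (OneStep R) y w ∧ ReflTransGen (OneStep R) z w

theorem OneStep.context {y z : Word A} (h : OneStep R y z) (u v : Word A) :
    OneStep R (u * y * v) (u * z * v) := by
  obtain ⟨u', v', l, r, hR, rfl, rfl⟩ := h
  exact ⟨u * u', v' * v, l, r, hR, by simp only [mul_assoc], by simp only [mul_assoc]⟩

theorem reflTransGen_context {y z : Word A} (h : ReflTransGen (OneStep R) y z) (u v : Word A) :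
    ReflTransGen (OneStep R) (u * y * v) (u * z * v) :=
  h.lift (fun w => u * w * v) fun _ _ h' => h'.context u v

theorem Joinable.symm {y z : Word A} (h : Joinable R y z) : Joinable R z y :=
  let ⟨w, h₁, h₂⟩ := h
  ⟨w, h₂, h₁⟩

theorem Joinable.refl (y : Word A) : Joinable R y y := ⟨y, .refl, .refl⟩

theorem Joinable.context {y z : Word A} (h : Joinable R y z) (u v : Word A) :
    Joinable R (u * y * v) (u * z * v) :=
  let ⟨w, h₁, h₂⟩ := h
  ⟨u * w * v, reflTransGen_context h₁ u v, reflTransGen_context h₂ u v⟩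

theorem oneStep_of_mem {l r : Word A} (h : (l, r) ∈ R) (u v : Word A) :
    OneStep R (u * l * v) (u * r * v) :=
  ⟨u, v, l, r, h, rfl, rfl⟩

theorem joinable_disjoint {l r l' r' : Word A} (h : (l, r) ∈ R) (h' : (l', r') ∈ R)
    (c v : Word A) : Joinable R (r * (c * l' * v)) (l * c * r' * v) := by
  refine ⟨r * c * r' * v, .single ?_, .single ?_⟩
  · simpa only [mul_assoc] using oneStep_of_mem h' (r * c) v
  · simpa only [mul_assoc, one_mul] using oneStep_of_mem h 1 (c * r' * v)

/-- Newman's lemma. -/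
theorem isConfluent_of_wellFounded (hwf : WellFounded (flip (OneStep R)))
    (hloc : ∀ w y z, OneStep R w y → OneStep R w z → Joinable R y z) : IsConfluent R := by
  intro w
  induction w using hwf.induction with
  | _ w ih =>
    intro y z hy hz
    obtain rfl | ⟨y₁, hy₁, hy⟩ := hy.cases_head
    · exact ⟨z, hz, .refl⟩
    obtain rfl | ⟨z₁, hz₁, hz⟩ := hz.cases_head
    · exact ⟨y, .refl, .head hy₁ hy⟩
    obtain ⟨m, hym, hzm⟩ := hloc w y₁ z₁ hy₁ hz₁
    obtain ⟨n, hyn, hmn⟩ := ih y₁ hy₁ y m hy hym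
    obtain ⟨o, hno, hzo⟩ := ih z₁ hz₁ n z (hzm.trans hmn) hz
    exact ⟨o, hyn.trans hno, hzo⟩

theorem isTerminating_of_wellFounded (hwf : WellFounded (flip (OneStep R))) :
    IsTerminating R := by
  rintro ⟨f, hf⟩
  obtain ⟨_, ⟨n, rfl⟩, hn⟩ := hwf.has_min (Set.range f) ⟨_, 0, rfl⟩
  exact hn _ ⟨n + 1, rfl⟩ (hf n)

theorem mul_eq_mul_cases {u v u' v' : Word A} (h : u * v = u' * v') :
    (∃ c : Word A, u' = u * c ∧ v = c * v') ∨ ∃ c : Word A, u = u' * c ∧ v' = c * v :=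
  List.append_eq_append_iff.1 h

/-- Local confluence only needs to be checked when the first redex is a prefix. -/
theorem joinable_of_overlaps
    (h : ∀ l r l' r' c v v' : Word A, (l, r) ∈ R → (l', r') ∈ R →
      l * v = c * (l' * v') → Joinable R (r * v) (c * r' * v'))
    (w y z : Word A) (hy : OneStep R w y) (hz : OneStep R w z) : Joinable R y z := by
  obtain ⟨u, v, l, r, hR, rfl, rfl⟩ := hy
  obtain ⟨u', v', l', r', hR', hw, rfl⟩ := hz
  rw [mul_assoc, mul_assoc] at hw
  obtain ⟨c, rfl, hcv⟩ | ⟨c, rfl, hcv⟩ := mul_eq_mul_cases hw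
  · have := (h l r l' r' c v v' hR hR' hcv).context u 1
    simpa only [mul_assoc, mul_one] using this
  · have := (h l' r' l r c v' v hR' hR hcv).symm.context u' 1
    simpa only [mul_assoc, mul_one] using this

end Rewriting

section Words

variable {A : Type}

theorem of_mul_inj_s5 {y z : A} {v w : Word A} (h : of y * v = of z * w) : y = z ∧ v = w :=
  List.cons.inj h

theorem of_mul_eq {y : A} {v c w : Word A} (h : of y * v = c * w) :
    (c = 1 ∧ of y * v = w) ∨ ∃ c', c = of y * c' ∧ v = c' * w := by
  cases c using FreeMonoid.casesOn with
  | one => exact .inl ⟨rfl, by simpa using h⟩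
  | of_mul z c' =>
    rw [mul_assoc] at h
    obtain ⟨rfl, h₁⟩ := of_mul_inj_s5 h
    exact .inr ⟨c', rfl, h₁⟩

/-- No occurrence of the letter `z` starts inside the word `l`. -/
def Avoids (z : A) (l : Word A) : Prop :=
  ∀ ⦃v c w : Word A⦄, l * v = c * (of z * w) → ∃ c', c = l * c' ∧ v = c' * (of z * w)

theorem Avoids.of {y z : A} (hyz : y ≠ z) : Avoids z (of y) := by
  intro v c w h
  obtain ⟨rfl, h₁⟩ | h₁ := of_mul_eq h
  · exact absurd (of_mul_inj_s5 h₁).1 hyz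
  · exact h₁

theorem Avoids.mul {z : A} {l m : Word A} (hl : Avoids z l) (hm : Avoids z m) :
    Avoids z (l * m) := by
  intro v c w h
  obtain ⟨c', rfl, h₁⟩ := hl ((mul_assoc _ _ _).symm.trans h)
  obtain ⟨c', rfl, h₂⟩ := hm h₁
  exact ⟨c', (mul_assoc _ _ _).symm, h₂⟩

theorem Avoids.pow {z : A} {l : Word A} (hl : Avoids z l) (n : ℕ) : Avoids z (l ^ n) := by
  induction n with
  | zero => exact fun v c w h => ⟨c, by simp, by simpa using h⟩
  | succ n ih => rw [pow_succ]; exact ih.mul hl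

theorem pow_mul_of_inj {y z z' : A} (hyz : y ≠ z) (hyz' : y ≠ z') {m n : ℕ} {v w : Word A}
    (h : of y ^ m * (of z * v) = of y ^ n * (of z' * w)) : m = n ∧ z = z' ∧ v = w := by
  induction m generalizing n with
  | zero =>
    cases n with
    | zero => exact ⟨rfl, of_mul_inj_s5 (by simpa using h)⟩
    | succ n =>
      rw [pow_succ', mul_assoc, pow_zero, one_mul] at h
      exact absurd (of_mul_inj_s5 h).1.symm hyz
  | succ m ih =>
    cases n with
    | zero =>
      rw [pow_succ', mul_assoc, pow_zero, one_mul] at h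
      exact absurd (of_mul_inj_s5 h).1 hyz'
    | succ n =>
      rw [pow_succ', pow_succ', mul_assoc, mul_assoc] at h
      obtain ⟨rfl, h₁⟩ := ih (of_mul_inj_s5 h).2
      exact ⟨rfl, h₁⟩

theorem pow_mul_ne {y z : A} (hyz : y ≠ z) {m n : ℕ} (hmn : n < m) (v w : Word A) :
    of y ^ m * v ≠ of y ^ n * (of z * w) := by
  obtain ⟨d, rfl⟩ := Nat.exists_eq_add_of_lt hmn
  intro h
  rw [add_assoc, pow_add, mul_assoc] at h
  have h := mul_left_cancel h
  rw [pow_succ', mul_assoc] at h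
  exact hyz (of_mul_inj_s5 h).1

theorem pow_mul_eq_pow_mul {y z z' : A} (hyz : y ≠ z) (hyz' : y ≠ z') {p : ℕ}
    {v c w : Word A} (h : of y ^ p * (of z * v) = c * (of y ^ p * (of z' * w))) :
    (c = 1 ∧ z = z' ∧ v = w) ∨
      ∃ c', c = of y ^ p * (of z * c') ∧ v = c' * (of y ^ p * (of z' * w)) := by
  obtain ⟨c', rfl, h₁⟩ | ⟨c', hc, h₁⟩ := mul_eq_mul_cases h
  · obtain ⟨rfl, h₂⟩ | ⟨c', rfl, h₂⟩ := of_mul_eq h₁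
    · rw [← one_mul (of z * v), ← pow_zero (of y)] at h₂
      obtain ⟨rfl, h₃⟩ := pow_mul_of_inj hyz hyz' h₂
      exact .inl ⟨by simp, h₃⟩
    · exact .inr ⟨c', rfl, h₂⟩
  · obtain ⟨d, rfl, h₂⟩ := (Avoids.of hyz).pow p h₁
    have h₃ : c.length + d.length = 0 := by
      have := congrArg FreeMonoid.length hc
      simp only [FreeMonoid.length_mul] at this
      omega
    obtain rfl : c = 1 := FreeMonoid.length_eq_zero.1 (by omega)
    obtain rfl : d = 1 := FreeMonoid.length_eq_zero.1 (by omega)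
    obtain ⟨rfl, rfl⟩ := of_mul_inj_s5 (h₂.trans (one_mul _))
    exact .inl ⟨rfl, rfl, rfl⟩

/-- The pattern `z y^q z` can only occur in `z (y^j z)^m v`, where `q < j`, at or after the last
of the displayed `z`. -/
theorem mul_block_pow_mul_eq {y z : A} (hyz : y ≠ z) {q j : ℕ} (hqj : q < j) (m : ℕ)
    {v c w : Word A}
    (h : of z * ((of y ^ j * of z) ^ m * v) = c * (of z * (of y ^ q * (of z * w)))) :
    ∃ c', c = (of z * of y ^ j) ^ m * c' ∧
      of z * v = c' * (of z * (of y ^ q * (of z * w))) := by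
  induction m generalizing c with
  | zero => exact ⟨c, by simp, by simpa using h⟩
  | succ m ih =>
    rw [pow_succ', mul_assoc, mul_assoc] at h
    obtain ⟨rfl, h₁⟩ | ⟨c', rfl, h₁⟩ := of_mul_eq h
    · exact absurd (of_mul_inj_s5 h₁).2 (pow_mul_ne hyz hqj _ _)
    · obtain ⟨c', rfl, h₂⟩ := (Avoids.of hyz).pow j h₁
      obtain ⟨c', rfl, h₃⟩ := ih h₂
      exact ⟨c', by simp only [pow_succ', mul_assoc], h₃⟩

theorem length_pow (w : Word A) (n : ℕ) : (w ^ n).length = n * w.length := by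
  induction n with
  | zero => simp
  | succ n ih => rw [pow_succ, FreeMonoid.length_mul, ih]; ring

end Words

section Monoids

variable {M : Type*} [Monoid M] {c b x : M} {q t k : ℕ}

theorem mul_pow_mul_comm (z y : M) (m : ℕ) :
    (z * y) ^ m * z = z * (y * z) ^ m := by
  induction m with
  | zero => simp
  | succ m ih => rw [pow_succ', mul_assoc, ih, pow_succ']; simp only [mul_assoc]

theorem block_pow_mul_pow (b x : M) (q t k : ℕ) :
    (b ^ (q + t) * x) ^ k * b ^ (q + t + 1) = b ^ t * (b ^ q * ((x * b ^ (q + t)) ^ k * b)) := by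
  rw [pow_succ b, ← mul_assoc, mul_pow_mul_comm, ← mul_assoc (b ^ t), ← pow_add, add_comm t,
    mul_assoc]

theorem pow_mul_mul_block_pow (h : c * b ^ (q + t + 1) * x = b) (i : ℕ) :
    c ^ i * b * (b ^ (q + t) * x) ^ i = b := by
  induction i with
  | zero => simp
  | succ i ih =>
    calc c ^ (i + 1) * b * (b ^ (q + t) * x) ^ (i + 1)
        = c ^ i * (c * b ^ (q + t + 1) * x) * (b ^ (q + t) * x) ^ i := by
          simp only [pow_succ c, pow_succ' b, pow_succ' (b ^ (q + t) * x), mul_assoc]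
      _ = b := by rw [h, ih]

theorem mul_eq_of_pow (h : c * b ^ (q + t + 1) * (c ^ (k + 2) * b ^ (t + 1)) = b) :
    c * b = c ^ (k + 2) * b ^ (t + 1) * b ^ q * (c ^ (k + 2) * b ^ (t + 1)) *
      (b ^ (q + t) * (c ^ (k + 2) * b ^ (t + 1))) ^ k := by
  set x := c ^ (k + 2) * b ^ (t + 1) with hx
  symm
  calc x * b ^ q * x * (b ^ (q + t) * x) ^ k
      = c * (c ^ k * (c * (b ^ (t + 1) * b ^ q) * x) * (b ^ (q + t) * x) ^ k) := by
        nth_rw 1 [hx]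
        rw [pow_succ c (k + 1), pow_succ' c k]
        simp only [mul_assoc]
    _ = c * b := by
        rw [← pow_add, show t + 1 + q = q + t + 1 by ring, h, pow_mul_mul_block_pow h]

theorem mul_eq_self_of_pow (h : c * b ^ (q + t + 1) * (c ^ (k + 2) * b ^ (t + 1)) = b) :
    c * (c ^ (k + 2) * b ^ (t + 1)) * b ^ q * (c ^ (k + 2) * b ^ (t + 1)) * b ^ t =
      c ^ (k + 2) * b ^ (t + 1) := by
  set x := c ^ (k + 2) * b ^ (t + 1) with hx
  calc c * x * b ^ q * x * b ^ t
      = c ^ (k + 2) * (c * (b ^ (t + 1) * b ^ q) * x) * b ^ t := by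
        nth_rw 1 [hx]
        rw [← mul_assoc c, ← pow_succ' c, pow_succ c]
        simp only [mul_assoc]
    _ = x := by
        rw [← pow_add, show t + 1 + q = q + t + 1 by ring, h, hx, pow_succ' b, mul_assoc]

theorem mul_block_pow_succ_eq (h : c * b ^ (q + t + 1) * x = b)
    (h₂ : c * b = x * b ^ q * x * (b ^ (q + t) * x) ^ k) :
    x * b ^ q * x * (b ^ (q + t) * x) ^ (k + 1) = b := by
  rw [pow_succ, ← mul_assoc, ← h₂]
  nth_rw 3 [← h]
  simp only [pow_succ' b, mul_assoc]

theorem mul_block_pow_mul_pow_eq (h : c * b ^ (q + t + 1) * x = b)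
    (h₂ : c * b = x * b ^ q * x * (b ^ (q + t) * x) ^ k) :
    x * b ^ q * x * (b ^ (q + t) * x) ^ k * b ^ (q + t + 1) =
      b ^ (q + 1) * x * (b ^ (q + t) * x) ^ (k + 1) := by
  have h₃ := mul_block_pow_succ_eq h h₂
  calc x * b ^ q * x * (b ^ (q + t) * x) ^ k * b ^ (q + t + 1)
      = c * b ^ (q + t + 1) * (x * b ^ q * x * (b ^ (q + t) * x) ^ (k + 1)) := by
        rw [← h₂, h₃, mul_assoc, mul_assoc, ← pow_succ, ← pow_succ']
    _ = (c * b ^ (q + t + 1) * x) * b ^ q * x * (b ^ (q + t) * x) ^ (k + 1) := by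
        simp only [mul_assoc]
    _ = b ^ (q + 1) * x * (b ^ (q + t) * x) ^ (k + 1) := by rw [h, pow_succ' b]

theorem pow_mul_pow_eq (h₁ : c * x * b ^ q * x * b ^ t = x)
    (h₂ : c * b = x * b ^ q * x * (b ^ (q + t) * x) ^ k) :
    c ^ (k + 2) * b ^ (t + 1) = x := by
  have key (i : ℕ) : c ^ i * (x * b ^ q * x * (b ^ (q + t) * x) ^ i) = x * b ^ q * x := by
    induction i with
    | zero => simp
    | succ i ih =>
      calc c ^ (i + 1) * (x * b ^ q * x * (b ^ (q + t) * x) ^ (i + 1))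
          = c ^ i * ((c * x * b ^ q * x * b ^ t) * b ^ q * x * (b ^ (q + t) * x) ^ i) := by
            rw [pow_succ' (b ^ (q + t) * x), pow_succ c, add_comm q t, pow_add b]
            simp only [mul_assoc]
        _ = x * b ^ q * x := by rw [h₁, ih]
  calc c ^ (k + 2) * b ^ (t + 1) = c * (c ^ k * (c * b)) * b ^ t := by
        rw [pow_succ' b, pow_succ, pow_succ']; simp only [mul_assoc]
    _ = x := by rw [h₂, key]; simpa only [mul_assoc] using h₁

theorem mul_pow_mul_eq (h₂ : c * b = x * b ^ q * x * (b ^ (q + t) * x) ^ k)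
    (h₃ : x * b ^ q * x * (b ^ (q + t) * x) ^ (k + 1) = b) :
    c * b ^ (q + t + 1) * x = b := by
  rw [pow_succ' b, ← mul_assoc, h₂, mul_assoc, mul_assoc, ← pow_succ]
  exact h₃

end Monoids

section System

variable {p q t k : ℕ}

/-- The four-rule system, with `s = t + 1` and `k + 2` in place of `k`. -/
def blockSystem (p q t k : ℕ) : Set (Word ABX × Word ABX) :=
  {((of ABX.a) ^ p * (of ABX.x) * (of ABX.b) ^ q * (of ABX.x) * (of ABX.b) ^ t, of ABX.x),
   ((of ABX.a) ^ p * (of ABX.b), (of ABX.x) * (of ABX.b) ^ q * (of ABX.x) *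
      ((of ABX.b) ^ (q + t) * (of ABX.x)) ^ k),
   ((of ABX.x) * (of ABX.b) ^ q * (of ABX.x) * ((of ABX.b) ^ (q + t) * (of ABX.x)) ^ (k + 1),
      of ABX.b),
   ((of ABX.x) * (of ABX.b) ^ q * (of ABX.x) * ((of ABX.b) ^ (q + t) * (of ABX.x)) ^ k *
      (of ABX.b) ^ (q + t + 1),
    (of ABX.b) ^ (q + 1) * (of ABX.x) * ((of ABX.b) ^ (q + t) * (of ABX.x)) ^ (k + 1))}

theorem oneStep_ab (u v : Word ABX) : OneStep (blockSystem p q t k)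
    (u * (of ABX.a ^ p * of ABX.b) * v)
    (u * (of ABX.x * of ABX.b ^ q * of ABX.x * (of ABX.b ^ (q + t) * of ABX.x) ^ k) * v) :=
  oneStep_of_mem (.inr (.inl rfl)) u v

theorem oneStep_block (u v : Word ABX) : OneStep (blockSystem p q t k)
    (u * (of ABX.x * of ABX.b ^ q * of ABX.x * (of ABX.b ^ (q + t) * of ABX.x) ^ (k + 1)) * v)
    (u * of ABX.b * v) :=
  oneStep_of_mem (.inr (.inr (.inl rfl))) u v

theorem oneStep_block_pow (u v : Word ABX) : OneStep (blockSystem p q t k)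
    (u * (of ABX.x * of ABX.b ^ q * of ABX.x * (of ABX.b ^ (q + t) * of ABX.x) ^ k *
      of ABX.b ^ (q + t + 1)) * v)
    (u * (of ABX.b ^ (q + 1) * of ABX.x * (of ABX.b ^ (q + t) * of ABX.x) ^ (k + 1)) * v) :=
  oneStep_of_mem (.inr (.inr (.inr rfl))) u v

/-- The overlap of the first and third rules. -/
theorem joinable_axbxb_block (v : Word ABX) : Joinable (blockSystem p q t k)
    (of ABX.x * (of ABX.b ^ q * (of ABX.x * ((of ABX.b ^ (q + t) * of ABX.x) ^ k * v))))
    (of ABX.a ^ p * of ABX.b * v) := by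
  refine ⟨_, .refl, .single ?_⟩
  simpa only [mul_assoc, one_mul] using oneStep_ab (p := p) (q := q) (t := t) (k := k) 1 v

/-- The overlap of the first and fourth rules. -/
theorem joinable_axbxb_block_pow (v : Word ABX) : Joinable (blockSystem p q t k)
    (of ABX.x * (of ABX.b ^ q * ((of ABX.x * of ABX.b ^ (q + t)) ^ k * (of ABX.b * v))))
    (of ABX.a ^ p * (of ABX.b ^ (q + 1) * of ABX.x *
      (of ABX.b ^ (q + t) * of ABX.x) ^ (k + 1)) * v) := by
  refine ⟨_, .refl, .tail
    (b := of ABX.x * of ABX.b ^ q * of ABX.x * (of ABX.b ^ (q + t) * of ABX.x) ^ k *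
      (of ABX.b ^ q * of ABX.x * (of ABX.b ^ (q + t) * of ABX.x) ^ (k + 1)) * v) (.single ?_) ?_⟩
  · simpa only [mul_assoc, one_mul, pow_succ' (of ABX.b) q] using
      oneStep_ab (p := p) (q := q) (t := t) (k := k) 1
        (of ABX.b ^ q * of ABX.x * (of ABX.b ^ (q + t) * of ABX.x) ^ (k + 1) * v)
  · rw [mul_assoc (of ABX.x * of ABX.b ^ q), ← mul_pow_mul_comm (of ABX.x)]
    simpa only [mul_assoc] using oneStep_block (p := p) (q := q) (t := t) (k := k)
      (of ABX.x * of ABX.b ^ q * (of ABX.x * of ABX.b ^ (q + t)) ^ k) v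

/-- The overlap of the third rule with itself. -/
theorem joinable_block_block (v : Word ABX) : Joinable (blockSystem p q t k)
    (of ABX.b * (of ABX.b ^ q * (of ABX.x * ((of ABX.b ^ (q + t) * of ABX.x) ^ (k + 1) * v))))
    (of ABX.x * (of ABX.b ^ q * (of ABX.x * of ABX.b ^ (q + t)) ^ (k + 1)) * of ABX.b * v) := by
  refine ⟨_, .refl, .single ?_⟩
  rw [pow_succ (of ABX.x * of ABX.b ^ (q + t)), ← mul_assoc (_ ^ k), mul_pow_mul_comm]
  simpa only [mul_assoc, one_mul, pow_succ' (of ABX.b) q, pow_succ (of ABX.b) (q + t)] using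
    oneStep_block_pow (p := p) (q := q) (t := t) (k := k) 1 v

/-- The overlap of the third and fourth rules. -/
theorem joinable_block_block_pow (v : Word ABX) : Joinable (blockSystem p q t k)
    (of ABX.b * (of ABX.b ^ q * (of ABX.x * ((of ABX.b ^ (q + t) * of ABX.x) ^ k *
      (of ABX.b ^ (q + t + 1) * v)))))
    (of ABX.x * (of ABX.b ^ q * (of ABX.x * of ABX.b ^ (q + t)) ^ (k + 1)) *
      (of ABX.b ^ (q + 1) * of ABX.x * (of ABX.b ^ (q + t) * of ABX.x) ^ (k + 1)) * v) := by
  refine ⟨_, .refl, .tail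
    (b := of ABX.b ^ (q + 1) * of ABX.x * (of ABX.b ^ (q + t) * of ABX.x) ^ (k + 1) *
      (of ABX.b ^ q * of ABX.x * (of ABX.b ^ (q + t) * of ABX.x) ^ (k + 1)) * v) (.single ?_) ?_⟩
  · rw [pow_succ (of ABX.x * of ABX.b ^ (q + t)), ← mul_assoc (_ ^ k), mul_pow_mul_comm]
    simpa only [mul_assoc, one_mul, pow_succ' (of ABX.b) q, pow_succ (of ABX.b) (q + t)] using
      oneStep_block_pow (p := p) (q := q) (t := t) (k := k) 1
        (of ABX.b ^ q * of ABX.x * (of ABX.b ^ (q + t) * of ABX.x) ^ (k + 1) * v)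
  · rw [mul_assoc (of ABX.b ^ (q + 1)), ← mul_pow_mul_comm (of ABX.x)]
    have h : of ABX.x * ((of ABX.b ^ (q + t) * of ABX.x) ^ k * (of ABX.b ^ (q + t + 1) * v)) =
        (of ABX.x * of ABX.b ^ (q + t)) ^ (k + 1) * (of ABX.b * v) := by
      rw [pow_succ (of ABX.x * of ABX.b ^ (q + t)), ← mul_assoc (of ABX.x), ← mul_pow_mul_comm,
        pow_succ (of ABX.b) (q + t)]
      simp only [mul_assoc]
    rw [h]
    simpa only [mul_assoc, pow_succ' (of ABX.b) q] using
      oneStep_block (p := p) (q := q) (t := t) (k := k)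
        (of ABX.b ^ (q + 1) * (of ABX.x * of ABX.b ^ (q + t)) ^ (k + 1)) v

theorem block_mul_eq (hqt : q < q + t) (m : ℕ) {v c w : Word ABX}
    (h : of ABX.x * (of ABX.b ^ q * (of ABX.x * ((of ABX.b ^ (q + t) * of ABX.x) ^ m * v))) =
      c * (of ABX.x * (of ABX.b ^ q * (of ABX.x * w)))) :
    (c = 1 ∧ (of ABX.b ^ (q + t) * of ABX.x) ^ m * v = w) ∨
      ∃ c', c = of ABX.x * (of ABX.b ^ q * (of ABX.x * of ABX.b ^ (q + t)) ^ m) * c' ∧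
        of ABX.x * v = c' * (of ABX.x * (of ABX.b ^ q * (of ABX.x * w))) := by
  obtain ⟨rfl, h₁⟩ | ⟨c', rfl, h₁⟩ := of_mul_eq h
  · exact .inl ⟨rfl, (of_mul_inj_s5 (mul_left_cancel (of_mul_inj_s5 h₁).2)).2⟩
  · obtain ⟨c', rfl, h₂⟩ := (Avoids.of (z := ABX.x) (by simp)).pow q h₁
    obtain ⟨c', rfl, h₃⟩ := mul_block_pow_mul_eq (by simp) hqt m h₂
    exact .inr ⟨c', by simp only [mul_assoc], h₃⟩

/-- Reduction of the overlaps of the third rule with a rule starting with `x b^q x`. -/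
theorem joinable_of_block_mul_eq (hqt : q < q + t) {l' r' v c w v' : Word ABX}
    (hR : (l', r') ∈ blockSystem p q t k)
    (hl' : l' * v' = of ABX.x * (of ABX.b ^ q * (of ABX.x * w)))
    (h : of ABX.x * (of ABX.b ^ q * (of ABX.x * ((of ABX.b ^ (q + t) * of ABX.x) ^ (k + 1) * v))) =
      c * (of ABX.x * (of ABX.b ^ q * (of ABX.x * w))))
    (h₀ : (of ABX.b ^ (q + t) * of ABX.x) ^ (k + 1) * v = w →
      Joinable (blockSystem p q t k) (of ABX.b * v) (r' * v'))
    (h₁ : v = of ABX.b ^ q * (of ABX.x * w) → Joinable (blockSystem p q t k) (of ABX.b * v)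
      (of ABX.x * (of ABX.b ^ q * (of ABX.x * of ABX.b ^ (q + t)) ^ (k + 1)) * r' * v')) :
    Joinable (blockSystem p q t k) (of ABX.b * v) (c * r' * v') := by
  obtain ⟨rfl, h'⟩ | ⟨c', rfl, h'⟩ := block_mul_eq hqt _ h
  · simpa using h₀ h'
  · obtain ⟨rfl, h''⟩ | ⟨c', rfl, h''⟩ := of_mul_eq h'
    · simpa using h₁ (of_mul_inj_s5 h'').2
    · rw [← hl'] at h''
      rw [h'']
      have := joinable_disjoint (R := blockSystem p q t k) (.inr (.inr (.inl rfl))) hR c' v'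
      rw [mul_assoc (of ABX.x * of ABX.b ^ q), ← mul_pow_mul_comm (of ABX.x)] at this
      simpa only [mul_assoc] using this

theorem joinable_of_block_pow_mul_eq (hqt : q < q + t) {l' r' v c w v' : Word ABX}
    (hR : (l', r') ∈ blockSystem p q t k)
    (hl' : l' * v' = of ABX.x * (of ABX.b ^ q * (of ABX.x * w)))
    (h : of ABX.x * (of ABX.b ^ q * (of ABX.x * ((of ABX.b ^ (q + t) * of ABX.x) ^ k *
      (of ABX.b ^ (q + t + 1) * v)))) = c * (of ABX.x * (of ABX.b ^ q * (of ABX.x * w))))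
    (h₀ : (of ABX.b ^ (q + t) * of ABX.x) ^ k * (of ABX.b ^ (q + t + 1) * v) = w →
      Joinable (blockSystem p q t k)
        (of ABX.b ^ (q + 1) * of ABX.x * (of ABX.b ^ (q + t) * of ABX.x) ^ (k + 1) * v)
        (r' * v')) :
    Joinable (blockSystem p q t k)
      (of ABX.b ^ (q + 1) * of ABX.x * (of ABX.b ^ (q + t) * of ABX.x) ^ (k + 1) * v)
      (c * r' * v') := by
  obtain ⟨rfl, h'⟩ | ⟨c', rfl, h'⟩ := block_mul_eq hqt _ h
  · simpa using h₀ h'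
  · obtain ⟨rfl, h''⟩ | ⟨c', rfl, h''⟩ := of_mul_eq h'
    · exact absurd (of_mul_inj_s5 h'').2 (pow_mul_ne (by simp) (by omega) _ _)
    · obtain ⟨c', rfl, h₃⟩ := (Avoids.of (z := ABX.x) (by simp)).pow (q + t + 1) h''
      rw [← hl'] at h₃
      rw [h₃]
      have := joinable_disjoint (R := blockSystem p q t k) (.inr (.inr (.inr rfl))) hR c' v'
      rw [mul_assoc (of ABX.x * of ABX.b ^ q), ← mul_pow_mul_comm (of ABX.x)] at this
      simpa only [mul_assoc] using this

theorem joinable_of_axbxb_mul_eq (hqt : q < t) {l' r' v c w v' : Word ABX}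
    (hR : (l', r') ∈ blockSystem p q t k)
    (hl' : l' * v' = of ABX.x * (of ABX.b ^ q * (of ABX.x * w)))
    (h : of ABX.a ^ p * (of ABX.x * (of ABX.b ^ q * (of ABX.x * (of ABX.b ^ t * v)))) =
      c * (of ABX.x * (of ABX.b ^ q * (of ABX.x * w))))
    (h₀ : of ABX.b ^ t * v = w →
      Joinable (blockSystem p q t k) (of ABX.x * v) (of ABX.a ^ p * r' * v')) :
    Joinable (blockSystem p q t k) (of ABX.x * v) (c * r' * v') := by
  obtain ⟨c', rfl, h₁⟩ := (Avoids.of (z := ABX.x) (by simp)).pow p h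
  obtain ⟨rfl, h₂⟩ | ⟨c', rfl, h₂⟩ := of_mul_eq h₁
  · simpa using h₀ (of_mul_inj_s5 (mul_left_cancel (of_mul_inj_s5 h₂).2)).2
  · obtain ⟨c', rfl, h₃⟩ := (Avoids.of (z := ABX.x) (by simp)).pow q h₂
    obtain ⟨rfl, h₄⟩ | ⟨c', rfl, h₄⟩ := of_mul_eq h₃
    · exact absurd (of_mul_inj_s5 h₄).2 (pow_mul_ne (by simp) hqt _ _)
    · obtain ⟨c', rfl, h₅⟩ := (Avoids.of (z := ABX.x) (by simp)).pow t h₄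
      rw [← hl'] at h₅
      rw [h₅]
      simpa only [mul_assoc] using
        joinable_disjoint (R := blockSystem p q t k) (.inl rfl) hR c' v'

theorem joinable_of_ab_mul_eq {l' r' v c w v' : Word ABX}
    (hR : (l', r') ∈ blockSystem p q t k) (hl' : l' * v' = of ABX.x * w)
    (h : of ABX.a ^ p * (of ABX.b * v) = c * (of ABX.x * w)) :
    Joinable (blockSystem p q t k) (of ABX.x * of ABX.b ^ q * of ABX.x *
      (of ABX.b ^ (q + t) * of ABX.x) ^ k * v) (c * r' * v') := by
  obtain ⟨c', rfl, h₁⟩ := (Avoids.of (z := ABX.x) (by simp)).pow p h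
  obtain ⟨c', rfl, h₂⟩ := Avoids.of (z := ABX.x) (by simp) h₁
  rw [← hl'] at h₂
  rw [h₂]
  simpa only [mul_assoc] using
    joinable_disjoint (R := blockSystem p q t k) (.inr (.inl rfl)) hR c' v'

theorem joinable_of_avoids {l r l' r' v c w v' : Word ABX}
    (hlR : (l, r) ∈ blockSystem p q t k) (hR : (l', r') ∈ blockSystem p q t k)
    (hl' : l' * v' = of ABX.a * w) (hl : Avoids ABX.a l) (h : l * v = c * (l' * v')) :
    Joinable (blockSystem p q t k) (r * v) (c * r' * v') := by
  obtain ⟨c', rfl, h₁⟩ := hl (hl' ▸ h)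
  rw [← hl'] at h₁
  rw [h₁]
  simpa only [mul_assoc] using joinable_disjoint hlR hR c' v'

theorem joinable_of_pow_mul_eq (hp : 1 ≤ p) {y y' : ABX} (hy : ABX.a ≠ y) (hy' : ABX.a ≠ y')
    {m r l' r' v c w v' : Word ABX}
    (hlR : (of ABX.a ^ p * (of y * m), r) ∈ blockSystem p q t k)
    (hR : (l', r') ∈ blockSystem p q t k)
    (hl' : l' * v' = of ABX.a ^ p * (of y' * w)) (hm : Avoids ABX.a m)
    (h : of ABX.a ^ p * (of y * (m * v)) = c * (of ABX.a ^ p * (of y' * w)))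
    (h₀ : y = y' → m * v = w → r * v = r' * v') :
    Joinable (blockSystem p q t k) (r * v) (c * r' * v') := by
  obtain ⟨rfl, h₁, h₂⟩ | ⟨c', rfl, h₁⟩ := pow_mul_eq_pow_mul hy hy' h
  · rw [h₀ h₁ h₂, one_mul]
    exact .refl _
  · obtain ⟨p, rfl⟩ := Nat.exists_eq_add_of_le' hp
    rw [pow_succ', mul_assoc] at h₁
    obtain ⟨c', rfl, h₂⟩ := hm h₁
    rw [← mul_assoc (of ABX.a), ← pow_succ', ← hl'] at h₂
    rw [h₂]
    simpa only [mul_assoc] using joinable_disjoint hlR hR c' v'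

theorem avoids_a_b_pow (n : ℕ) : Avoids ABX.a (of ABX.b ^ n) := (Avoids.of (by simp)).pow n

theorem avoids_a_block (q t n : ℕ) : Avoids ABX.a
    (of ABX.x * of ABX.b ^ q * of ABX.x * (of ABX.b ^ (q + t) * of ABX.x) ^ n) :=
  have hx : Avoids ABX.a (of ABX.x) := .of (by simp)
  ((hx.mul (avoids_a_b_pow q)).mul hx).mul (((avoids_a_b_pow _).mul hx).pow n)

theorem avoids_a_bxb (q t : ℕ) : Avoids ABX.a
    (of ABX.b ^ q * of ABX.x * of ABX.b ^ t) :=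
  ((avoids_a_b_pow q).mul (.of (by simp))).mul (avoids_a_b_pow t)

theorem joinable_of_mul_eq (hp : 1 ≤ p) (hqt : q < t) (l r l' r' c v v' : Word ABX)
    (hR : (l, r) ∈ blockSystem p q t k) (hR' : (l', r') ∈ blockSystem p q t k)
    (h : l * v = c * (l' * v')) :
    Joinable (blockSystem p q t k) (r * v) (c * r' * v') := by
  obtain ⟨p₀, rfl⟩ := Nat.exists_eq_add_of_le' hp
  have hqj : q < q + t := by omega
  have h₁ := hR
  have h₂ := hR'
  simp only [blockSystem, Set.mem_insert_iff, Set.mem_singleton_iff, Prod.mk.injEq] at h₁ h₂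
  obtain ⟨rfl, rfl⟩ | ⟨rfl, rfl⟩ | ⟨rfl, rfl⟩ | ⟨rfl, rfl⟩ := h₁
  · have hlR := hR
    rw [show of ABX.a ^ (p₀ + 1) * of ABX.x * of ABX.b ^ q * of ABX.x * of ABX.b ^ t =
      of ABX.a ^ (p₀ + 1) * (of ABX.x * (of ABX.b ^ q * of ABX.x * of ABX.b ^ t)) by
        simp only [mul_assoc]] at hlR
    obtain ⟨rfl, rfl⟩ | ⟨rfl, rfl⟩ | ⟨rfl, rfl⟩ | ⟨rfl, rfl⟩ := h₂
    · refine joinable_of_pow_mul_eq hp (y' := ABX.x) (by simp) (by simp) hlR hR'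
        (by simp only [mul_assoc]; rfl) (avoids_a_bxb q t) (by simpa only [mul_assoc] using h) ?_
      simp only [mul_assoc]
      intro _ h'
      rw [mul_left_cancel (mul_left_cancel (mul_left_cancel h'))]
    · refine joinable_of_pow_mul_eq hp (y' := ABX.b) (by simp) (by simp) hlR hR'
        (by simp only [mul_assoc]; rfl) (avoids_a_bxb q t) (by simpa only [mul_assoc] using h) ?_
      simp
    · refine joinable_of_axbxb_mul_eq hqt hR' (by simp only [mul_assoc]; rfl)
        (by simpa only [mul_assoc] using h) fun h' => ?_
      have h'' : v = of ABX.b ^ q * (of ABX.x * ((of ABX.b ^ (q + t) * of ABX.x) ^ k * v')) := by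
        apply mul_left_cancel (a := of ABX.b ^ t)
        rw [h', ← mul_assoc (of ABX.b ^ t), ← pow_add, add_comm t q, pow_succ']
        simp only [mul_assoc]
      rw [h'']
      exact joinable_axbxb_block v'
    · refine joinable_of_axbxb_mul_eq hqt hR' (by simp only [mul_assoc]; rfl)
        (by simpa only [mul_assoc] using h) fun h' => ?_
      rw [← mul_assoc (_ ^ k), block_pow_mul_pow] at h'
      simp only [mul_assoc] at h'
      rw [mul_left_cancel h']
      exact joinable_axbxb_block_pow v'
  · obtain ⟨rfl, rfl⟩ | ⟨rfl, rfl⟩ | ⟨rfl, rfl⟩ | ⟨rfl, rfl⟩ := h₂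
    · refine joinable_of_pow_mul_eq hp (y := ABX.b) (y' := ABX.x) (m := of ABX.b ^ 0) (by simp)
        (by simp) (by rwa [pow_zero, mul_one]) hR' (by simp only [mul_assoc]; rfl)
        (avoids_a_b_pow 0) (by simpa only [mul_assoc, pow_zero, one_mul] using h) ?_
      simp
    · refine joinable_of_pow_mul_eq hp (y := ABX.b) (y' := ABX.b) (m := of ABX.b ^ 0) (by simp)
        (by simp) (by rwa [pow_zero, mul_one]) hR' (by simp only [mul_assoc]; rfl)
        (avoids_a_b_pow 0) (by simpa only [mul_assoc, pow_zero, one_mul] using h) ?_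
      rw [pow_zero, one_mul]
      rintro _ rfl
      rfl
    · exact joinable_of_ab_mul_eq hR' (by simp only [mul_assoc]; rfl)
        (by simpa only [mul_assoc] using h)
    · exact joinable_of_ab_mul_eq hR' (by simp only [mul_assoc]; rfl)
        (by simpa only [mul_assoc] using h)
  · obtain ⟨rfl, rfl⟩ | ⟨rfl, rfl⟩ | ⟨rfl, rfl⟩ | ⟨rfl, rfl⟩ := h₂
    · exact joinable_of_avoids hR hR' (by simp only [pow_succ', mul_assoc]; rfl)
        (avoids_a_block q t _) h
    · exact joinable_of_avoids hR hR' (by simp only [pow_succ', mul_assoc]; rfl)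
        (avoids_a_block q t _) h
    · refine joinable_of_block_mul_eq hqj hR' (by simp only [mul_assoc]; rfl)
        (by simpa only [mul_assoc] using h) (fun h' => ?_) fun h' => ?_
      · rw [mul_left_cancel h']
        exact .refl _
      · rw [h']
        exact joinable_block_block v'
    · refine joinable_of_block_mul_eq hqj hR' (by simp only [mul_assoc]; rfl)
        (by simpa only [mul_assoc] using h) (fun h' => ?_) fun h' => ?_
      · rw [pow_succ, mul_assoc] at h'
        have h' := mul_left_cancel h'
        rw [mul_assoc] at h'
        exact absurd h'.symm (pow_mul_ne (by simp) (by omega) _ _)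
      · rw [h']
        exact joinable_block_block_pow v'
  · obtain ⟨rfl, rfl⟩ | ⟨rfl, rfl⟩ | ⟨rfl, rfl⟩ | ⟨rfl, rfl⟩ := h₂
    · exact joinable_of_avoids hR hR' (by simp only [pow_succ', mul_assoc]; rfl)
        ((avoids_a_block q t _).mul (avoids_a_b_pow _)) h
    · exact joinable_of_avoids hR hR' (by simp only [pow_succ', mul_assoc]; rfl)
        ((avoids_a_block q t _).mul (avoids_a_b_pow _)) h
    · refine joinable_of_block_pow_mul_eq hqj hR' (by simp only [mul_assoc]; rfl)
        (by simpa only [mul_assoc] using h) (fun h' => ?_)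
      rw [pow_succ (of ABX.b ^ (q + t) * of ABX.x), mul_assoc] at h'
      have h' := mul_left_cancel h'
      rw [mul_assoc] at h'
      exact absurd h' (pow_mul_ne (by simp) (by omega) _ _)
    · refine joinable_of_block_pow_mul_eq hqj hR' (by simp only [mul_assoc]; rfl)
        (by simpa only [mul_assoc] using h) (fun h' => ?_)
      rw [mul_left_cancel (mul_left_cancel h')]
      exact .refl _

end System

section Termination

variable {p q t k : ℕ}

/-- The number of occurrences of the letter `a`. -/
def aCount (w : Word ABX) : ℕ :=
  (FreeMonoid.lift (M := Multiplicative ℕ)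
    (fun | .a => Multiplicative.ofAdd 1 | _ => 1) w).toAdd

theorem aCount_mul (v w : Word ABX) : aCount (v * w) = aCount v + aCount w := by
  simp [aCount]

theorem aCount_pow (w : Word ABX) (n : ℕ) : aCount (w ^ n) = n * aCount w := by
  simp [aCount]

theorem aCount_a : aCount (of ABX.a) = 1 := rfl

theorem aCount_b : aCount (of ABX.b) = 0 := rfl

theorem aCount_x : aCount (of ABX.x) = 0 := rfl

/-- The number whose binary digits are the letters of a word, with `x` read as `1` and the other
letters read as `0`. -/
def binaryValue : List ABX → ℕ
  | [] => 0
  | .x :: w => 2 ^ w.length + binaryValue w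
  | .a :: w => binaryValue w
  | .b :: w => binaryValue w

theorem binaryValue_append (v w : List ABX) :
    binaryValue (v ++ w) = binaryValue v * 2 ^ w.length + binaryValue w := by
  induction v with
  | nil => simp [binaryValue]
  | cons y v ih =>
    cases y <;> simp only [List.cons_append, binaryValue, ih, List.length_append]
    ring

theorem binaryValue_lt (w : List ABX) : binaryValue w < 2 ^ w.length := by
  induction w with
  | nil => simp [binaryValue]
  | cons y w ih => cases y <;> simp only [binaryValue, List.length_cons, pow_succ] <;> omega

theorem binaryValue_mul (v w : Word ABX) :
    binaryValue (v * w).toList =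
      binaryValue v.toList * 2 ^ w.length + binaryValue w.toList :=
  binaryValue_append v.toList w.toList

theorem binaryValue_b_mul_lt {v w : Word ABX} (h : v.length = w.length) :
    binaryValue (of ABX.b * w).toList < binaryValue (of ABX.x * v).toList := by
  rw [binaryValue_mul, binaryValue_mul, h]
  have : binaryValue w.toList < 2 ^ w.length := binaryValue_lt w.toList
  simp only [binaryValue, toList_of, List.length_nil]
  omega

theorem decreasing_of_mem (hp : 1 ≤ p) {l r : Word ABX}
    (h : (l, r) ∈ blockSystem p q t k) :
    aCount r < aCount l ∨ aCount r = aCount l ∧ (r.length < l.length ∨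
      r.length = l.length ∧ binaryValue r.toList < binaryValue l.toList) := by
  simp only [blockSystem, Set.mem_insert_iff, Set.mem_singleton_iff, Prod.mk.injEq] at h
  obtain ⟨rfl, rfl⟩ | ⟨rfl, rfl⟩ | ⟨rfl, rfl⟩ | ⟨rfl, rfl⟩ := h
  · left
    simp only [aCount_mul, aCount_pow, aCount_a, aCount_b, aCount_x]
    omega
  · left
    simp only [aCount_mul, aCount_pow, aCount_a, aCount_b, aCount_x]
    omega
  · right
    refine ⟨by simp only [aCount_mul, aCount_pow, aCount_b, aCount_x, mul_zero, add_zero],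
      .inl ?_⟩
    simp only [FreeMonoid.length_mul, length_pow, FreeMonoid.length_of]
    omega
  · right
    refine ⟨by simp only [aCount_mul, aCount_pow, aCount_b, aCount_x, mul_zero, add_zero],
      .inr ⟨?_, ?_⟩⟩
    · simp only [FreeMonoid.length_mul, length_pow, FreeMonoid.length_of]
      ring
    · rw [pow_succ' (of ABX.b) q]
      simp only [mul_assoc]
      apply binaryValue_b_mul_lt
      simp only [FreeMonoid.length_mul, length_pow, FreeMonoid.length_of]
      ring

theorem wellFounded_flip_oneStep (hp : 1 ≤ p) :
    WellFounded (flip (OneStep (blockSystem p q t k))) := by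
  refine Subrelation.wf (r := InvImage (Prod.Lex (· < ·) (Prod.Lex (· < ·) (· < ·)))
    fun w : Word ABX => (aCount w, w.length, binaryValue w.toList)) ?_
    (InvImage.wf _ (wellFounded_lt.prod_lex (wellFounded_lt.prod_lex wellFounded_lt)))
  rintro y z ⟨u, v, l, r, hR, rfl, rfl⟩
  simp only [InvImage, Prod.lex_def, aCount_mul, FreeMonoid.length_mul, binaryValue_mul]
  obtain h | ⟨h₁, h | ⟨h₂, h⟩⟩ := decreasing_of_mem hp hR
  · left; omega
  · right; exact ⟨by omega, .inl (by omega)⟩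
  · right
    refine ⟨by omega, .inr ⟨by omega, ?_⟩⟩
    rw [h₂]
    gcongr

end Termination

section Presentation

theorem presMk_eq_of_mem {A : Type} {R : Set (Word A × Word A)} {l r : Word A} (h : (l, r) ∈ R) :
    presMk R l = presMk R r :=
  (Con.eq _).2 (ConGen.Rel.of _ _ h)

/-- The monoid homomorphism out of a presented monoid determined by the images of the
generators. -/
def presLift {A : Type} {M : Type*} [Monoid M] (R : Set (Word A × Word A)) (f : A → M)
    (h : ∀ l r, (l, r) ∈ R → FreeMonoid.lift f l = FreeMonoid.lift f r) : MonPres R →* M :=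
  Con.lift _ (FreeMonoid.lift f) (Con.conGen_le.2 fun l r hR => h l r hR)

theorem presLift_of {A : Type} {M : Type*} [Monoid M] {R : Set (Word A × Word A)} {f : A → M}
    (h : ∀ l r, (l, r) ∈ R → FreeMonoid.lift f l = FreeMonoid.lift f r) (y : A) :
    presLift R f h (presMk R (of y)) = f y := by
  simp [presLift, presMk]

theorem presHom_ext {A : Type} {M : Type*} [Monoid M] {R : Set (Word A × Word A)}
    {f g : MonPres R →* M} (h : ∀ y, f (presMk R (of y)) = g (presMk R (of y))) : f = g :=
  Con.hom_ext (FreeMonoid.hom_eq h)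

/-- The one-relator system, with `s = t + 1` and `k + 2` in place of `k`. -/
def oneRelator (p q t k : ℕ) : Set (Word AB × Word AB) :=
  {((of AB.a) ^ p * (of AB.b) ^ (q + t + 1) * (of AB.a) ^ (p * (k + 2)) * (of AB.b) ^ (t + 1),
    of AB.b)}

theorem nonempty_mulEquiv_oneRelator (p q t k : ℕ) :
    Nonempty (MonPres (blockSystem p q t k) ≃* MonPres (oneRelator p q t k)) := by
  set R := blockSystem p q t k with hR
  set S := oneRelator p q t k with hS
  set a := presMk S (of AB.a) with ha
  set b := presMk S (of AB.b) with hb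
  have hrel : a ^ p * b ^ (q + t + 1) * ((a ^ p) ^ (k + 2) * b ^ (t + 1)) = b := by
    have := presMk_eq_of_mem (R := S) rfl
    simpa only [map_mul, map_pow, pow_mul, mul_assoc] using this
  set a' := presMk R (of ABX.a) with ha'
  set b' := presMk R (of ABX.b) with hb'
  set x' := presMk R (of ABX.x) with hx'
  have h₁ : a' ^ p * x' * b' ^ q * x' * b' ^ t = x' := by
    simpa only [map_mul, map_pow] using presMk_eq_of_mem (R := R) (.inl rfl)
  have h₂ : a' ^ p * b' = x' * b' ^ q * x' * (b' ^ (q + t) * x') ^ k := by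
    simpa only [map_mul, map_pow] using presMk_eq_of_mem (R := R) (.inr (.inl rfl))
  have h₃ : x' * b' ^ q * x' * (b' ^ (q + t) * x') ^ (k + 1) = b' := by
    simpa only [map_mul, map_pow] using presMk_eq_of_mem (R := R) (.inr (.inr (.inl rfl)))
  have hx := pow_mul_pow_eq h₁ h₂
  let f : MonPres R →* MonPres S :=
    presLift R (fun | .a => a | .b => b | .x => (a ^ p) ^ (k + 2) * b ^ (t + 1)) <| by
      intro l r h
      simp only [hR, blockSystem, Set.mem_insert_iff, Set.mem_singleton_iff, Prod.mk.injEq] at h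
      obtain ⟨rfl, rfl⟩ | ⟨rfl, rfl⟩ | ⟨rfl, rfl⟩ | ⟨rfl, rfl⟩ := h <;>
        simp only [map_mul, map_pow, FreeMonoid.lift_eval_of]
      · exact mul_eq_self_of_pow hrel
      · exact mul_eq_of_pow hrel
      · exact mul_block_pow_succ_eq hrel (mul_eq_of_pow hrel)
      · exact mul_block_pow_mul_pow_eq hrel (mul_eq_of_pow hrel)
  let g : MonPres S →* MonPres R :=
    presLift S (fun | .a => a' | .b => b') <| by
      intro l r h
      simp only [hS, oneRelator, Set.mem_singleton_iff, Prod.mk.injEq] at h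
      obtain ⟨rfl, rfl⟩ := h
      simp only [map_mul, map_pow, FreeMonoid.lift_eval_of]
      rw [mul_assoc, pow_mul, hx]
      exact mul_pow_mul_eq h₂ h₃
  have ga : g a = a' := presLift_of _ _
  have gb : g b = b' := presLift_of _ _
  have fa : f a' = a := presLift_of _ _
  have fb : f b' = b := presLift_of _ _
  have fx : f x' = (a ^ p) ^ (k + 2) * b ^ (t + 1) := presLift_of _ _
  refine ⟨MonoidHom.toMulEquiv f g (presHom_ext ?_) (presHom_ext ?_)⟩
  · rintro (_ | _ | _)
    · exact (congrArg g fa).trans ga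
    · exact (congrArg g fb).trans gb
    · refine (congrArg g fx).trans ?_
      rw [map_mul, map_pow, map_pow, map_pow, ga, gb, hx]
      rfl
  · rintro (_ | _)
    · exact (congrArg f ga).trans fa
    · exact (congrArg f gb).trans fb

end Presentation

/-- Case 4 with `q < s - 1`: the four-rule system on `{a,b,x}` is complete and presents
`Mon⟨a,b : a^p b^(q+s) a^(pk) b^s = b⟩`. -/
theorem stmt5 (p s k q : ℕ) (hp : 1 ≤ p) (hs : 2 ≤ s) (hk : 2 ≤ k) (hq : q < s - 1) :
    IsConfluent (({((of ABX.a)^p * (of ABX.x) * (of ABX.b)^q * (of ABX.x) * (of ABX.b)^(s-1), of ABX.x),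
       ((of ABX.a)^p * (of ABX.b), (of ABX.x) * (of ABX.b)^q * (of ABX.x) * ((of ABX.b)^(q+s-1) * (of ABX.x))^(k-2)),
       ((of ABX.x) * (of ABX.b)^q * (of ABX.x) * ((of ABX.b)^(q+s-1) * (of ABX.x))^(k-1), of ABX.b),
       ((of ABX.x) * (of ABX.b)^q * (of ABX.x) * ((of ABX.b)^(q+s-1) * (of ABX.x))^(k-2) * (of ABX.b)^(q+s),
        (of ABX.b)^(q+1) * (of ABX.x) * ((of ABX.b)^(q+s-1) * (of ABX.x))^(k-1))} : Set (Word ABX × Word ABX))) ∧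
    IsTerminating (({((of ABX.a)^p * (of ABX.x) * (of ABX.b)^q * (of ABX.x) * (of ABX.b)^(s-1), of ABX.x),
       ((of ABX.a)^p * (of ABX.b), (of ABX.x) * (of ABX.b)^q * (of ABX.x) * ((of ABX.b)^(q+s-1) * (of ABX.x))^(k-2)),
       ((of ABX.x) * (of ABX.b)^q * (of ABX.x) * ((of ABX.b)^(q+s-1) * (of ABX.x))^(k-1), of ABX.b),
       ((of ABX.x) * (of ABX.b)^q * (of ABX.x) * ((of ABX.b)^(q+s-1) * (of ABX.x))^(k-2) * (of ABX.b)^(q+s),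
        (of ABX.b)^(q+1) * (of ABX.x) * ((of ABX.b)^(q+s-1) * (of ABX.x))^(k-1))} : Set (Word ABX × Word ABX))) ∧
    Nonempty (MonPres (({((of ABX.a)^p * (of ABX.x) * (of ABX.b)^q * (of ABX.x) * (of ABX.b)^(s-1), of ABX.x),
       ((of ABX.a)^p * (of ABX.b), (of ABX.x) * (of ABX.b)^q * (of ABX.x) * ((of ABX.b)^(q+s-1) * (of ABX.x))^(k-2)),
       ((of ABX.x) * (of ABX.b)^q * (of ABX.x) * ((of ABX.b)^(q+s-1) * (of ABX.x))^(k-1), of ABX.b),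
       ((of ABX.x) * (of ABX.b)^q * (of ABX.x) * ((of ABX.b)^(q+s-1) * (of ABX.x))^(k-2) * (of ABX.b)^(q+s),
        (of ABX.b)^(q+1) * (of ABX.x) * ((of ABX.b)^(q+s-1) * (of ABX.x))^(k-1))} : Set (Word ABX × Word ABX))) ≃*
      MonPres (({((of AB.a)^p * (of AB.b)^(q+s) * (of AB.a)^(p*k) * (of AB.b)^s, of AB.b)} : Set (Word AB × Word AB)))) := by
  obtain ⟨t, rfl⟩ := Nat.exists_eq_add_of_le' (one_le_two.trans hs)
  obtain ⟨k, rfl⟩ := Nat.exists_eq_add_of_le' hk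
  have hqt : q < t := hq
  have hwf := wellFounded_flip_oneStep (q := q) (t := t) (k := k) hp
  exact ⟨isConfluent_of_wellFounded hwf (joinable_of_overlaps (joinable_of_mul_eq hp hqt)),
    isTerminating_of_wellFounded hwf, nonempty_mulEquiv_oneRelator p q t k⟩
end
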